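/- Every maximal left ideal of a nest algebra T(N) is strongly constructible, i.e. can be specified by a net (N_α, x_α) with all x_α unit vectors. -/

import Mathlib

noncomputable section

universe u

variable {H : Type u} [NormedAddCommGroup H] [InnerProductSpace ℂ H] [CompleteSpace H]
  [TopologicalSpace.SeparableSpace H]

/-- A nest: a linearly ordered set of orthogonal projections containing `0` and `1`. -/
structure Nest (H : Type u) [NormedAddCommGroup H] [InnerProductSpace ℂ H]
    [CompleteSpace H] where
  carrier : Set (H →L[ℂ] H)
  isProj : ∀ P ∈ carrier, IsSelfAdjoint P ∧ P * P = P
  zero_mem : (0 : H →L[ℂ] H) ∈ carrier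
  one_mem : (1 : H →L[ℂ] H) ∈ carrier
  chain : ∀ P ∈ carrier, ∀ Q ∈ carrier, Q * P = P ∨ P * Q = Q

/-- Order on projections: `P ≤ Q` iff `ran P ⊆ ran Q`. -/
def projLE (P Q : H →L[ℂ] H) : Prop := Q * P = P

/-- Strict order on projections. -/
def projLT (P Q : H →L[ℂ] H) : Prop := projLE P Q ∧ P ≠ Q

/-- The nest algebra: all bounded operators leaving invariant the range of every
projection in the nest, i.e. `(1 - P) X P = 0` for every `P` in the nest. -/
def nestAlgebra (𝒩 : Nest H) : Subalgebra ℂ (H →L[ℂ] H) where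
  carrier := {X | ∀ P ∈ 𝒩.carrier, (1 - P) * X * P = 0}
  mul_mem' := by
    intro X Y hX hY P hP
    have hX' := hX P hP
    have hY' := hY P hP
    have hYP : Y * P = P * (Y * P) := by
      have h : (1 - P) * Y * P + P * Y * P = Y * P := by noncomm_ring
      rw [hY', zero_add] at h
      rw [← mul_assoc]; exact h.symm
    calc (1 - P) * (X * Y) * P = (1 - P) * X * (Y * P) := by noncomm_ring
      _ = (1 - P) * X * (P * (Y * P)) := by rw [← hYP]
      _ = ((1 - P) * X * P) * (Y * P) := by noncomm_ring
      _ = 0 := by rw [hX', zero_mul]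
  one_mem' := by
    intro P hP
    have h := (𝒩.isProj P hP).2
    calc (1 - P) * 1 * P = P - P * P := by noncomm_ring
      _ = 0 := by rw [h, sub_self]
  add_mem' := by
    intro X Y hX hY P hP
    have hX' := hX P hP
    have hY' := hY P hP
    calc (1 - P) * (X + Y) * P = (1 - P) * X * P + (1 - P) * Y * P := by noncomm_ring
      _ = 0 := by rw [hX', hY', add_zero]
  zero_mem' := by intro P hP; simp
  algebraMap_mem' := by
    intro c P hP
    have h := (𝒩.isProj P hP).2
    have h1 : (1 - P) * 1 * P = 0 := by
      calc (1 - P) * 1 * P = P - P * P := by noncomm_ring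
        _ = 0 := by rw [h, sub_self]
    calc (1 - P) * (algebraMap ℂ (H →L[ℂ] H) c) * P
        = (1 - P) * (c • (1 : H →L[ℂ] H)) * P := by rw [Algebra.algebraMap_eq_smul_one]
      _ = c • ((1 - P) * 1 * P) := by rw [mul_smul_comm, smul_mul_assoc]
      _ = 0 := by rw [h1, smul_zero]

/-- The left ideal specified by a net `(N_α, x_α)`:
`{X ∈ T(𝒩) : lim_α ‖(I - N_α) X x_α‖ = 0}`. -/
def constructedIdeal (𝒩 : Nest H) {A : Type u} [Preorder A]
    (Nf : A → H →L[ℂ] H) (x : A → H) : Set (H →L[ℂ] H) :=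
  {X | X ∈ nestAlgebra 𝒩 ∧
    Filter.Tendsto (fun α => ‖(1 - Nf α) (X (x α))‖) Filter.atTop (nhds 0)}

/-- `L` is a left ideal of the nest algebra `T(𝒩)`. -/
def IsLeftIdealOf (𝒩 : Nest H) (L : Set (H →L[ℂ] H)) : Prop :=
  L ⊆ (nestAlgebra 𝒩 : Set (H →L[ℂ] H)) ∧ (0 : H →L[ℂ] H) ∈ L ∧
    (∀ X ∈ L, ∀ Y ∈ L, X + Y ∈ L) ∧ (∀ c : ℂ, ∀ X ∈ L, c • X ∈ L) ∧
    (∀ T ∈ nestAlgebra 𝒩, ∀ X ∈ L, T * X ∈ L)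

/-- A left ideal is constructible if it is specified by some net `(N_α, x_α)` in `𝒩 × H`. -/
def IsConstructible (𝒩 : Nest H) (L : Set (H →L[ℂ] H)) : Prop :=
  ∃ (A : Type u) (_ : Preorder A) (_ : IsDirected A (· ≤ ·)) (_ : Nonempty A)
    (Nf : A → H →L[ℂ] H) (x : A → H),
    (∀ α, Nf α ∈ 𝒩.carrier) ∧ L = constructedIdeal 𝒩 Nf x

/-- A left ideal is strongly constructible if it is specified by some net `(N_α, x_α)`
in which every vector `x_α = (I - N_α) x_α` is a unit vector. -/
def IsStronglyConstructible (𝒩 : Nest H) (L : Set (H →L[ℂ] H)) : Prop :=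
  ∃ (A : Type u) (_ : Preorder A) (_ : IsDirected A (· ≤ ·)) (_ : Nonempty A)
    (Nf : A → H →L[ℂ] H) (x : A → H),
    (∀ α, Nf α ∈ 𝒩.carrier) ∧ (∀ α, ‖x α‖ = 1) ∧ (∀ α, (1 - Nf α) (x α) = x α) ∧
    L = constructedIdeal 𝒩 Nf x

/-- `L` is a maximal (proper) left ideal of the nest algebra `T(𝒩)`. -/
def IsMaximalLeftIdealOf (𝒩 : Nest H) (L : Set (H →L[ℂ] H)) : Prop :=
  IsLeftIdealOf 𝒩 L ∧ L ≠ (nestAlgebra 𝒩 : Set (H →L[ℂ] H)) ∧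
    ∀ L', IsLeftIdealOf 𝒩 L' → L ⊆ L' →
      L' = L ∨ L' = (nestAlgebra 𝒩 : Set (H →L[ℂ] H))

/-- Douglas factorization: a map dominated in norm by `M` factors contractively through `M`. -/
theorem exists_contraction_comp_eq {Y K E : Type*}
    [NormedAddCommGroup Y] [InnerProductSpace ℂ Y]
    [NormedAddCommGroup K] [InnerProductSpace ℂ K] [CompleteSpace K]
    [NormedAddCommGroup E] [InnerProductSpace ℂ E] [CompleteSpace E]
    (M : Y →L[ℂ] K) (B : Y →L[ℂ] E) (h : ∀ y, ‖B y‖ ≤ ‖M y‖) :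
    ∃ G : K →L[ℂ] E, (∀ k, ‖G k‖ ≤ ‖k‖) ∧ ∀ y, G (M y) = B y := by
  set V : Submodule ℂ K := (LinearMap.range M.toLinearMap).topologicalClosure with hV
  have hVc : IsClosed (V : Set K) := Submodule.isClosed_topologicalClosure _
  have : CompleteSpace V := hVc.completeSpace_coe
  have hmem : ∀ y, M y ∈ V := fun y => Submodule.le_topologicalClosure _ ⟨y, rfl⟩
  let e : Y →ₗ[ℂ] V := M.toLinearMap.codRestrict V hmem
  have he : DenseRange e := by
    rintro ⟨v, hv⟩
    rw [Metric.mem_closure_iff]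
    intro ε hε
    obtain ⟨_, ⟨y, rfl⟩, hy⟩ := Metric.mem_closure_iff.1 hv ε hε
    exact ⟨e y, ⟨y, rfl⟩, hy⟩
  have hb : ∀ y, ‖B.toLinearMap y‖ ≤ 1 * ‖e y‖ := fun y => by
    rw [one_mul]; exact h y
  refine ⟨(B.toLinearMap.extendOfNorm e).comp V.orthogonalProjectionOnto, fun k => ?_, fun y => ?_⟩
  · calc _ ≤ 1 * ‖V.orthogonalProjectionOnto k‖ :=
          LinearMap.norm_extendOfNorm_apply_le he 1 hb _
      _ ≤ ‖k‖ := by rw [one_mul]; exact V.norm_orthogonalProjectionOnto_apply_le k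
  · have : V.orthogonalProjectionOnto (M y) = e y :=
      V.orthogonalProjectionOnto_mem_subspace_eq_self (e y)
    rw [ContinuousLinearMap.comp_apply, this]
    exact LinearMap.extendOfNorm_eq he ⟨1, hb⟩ y

/-- The defect operator of an operator bounded by `C`. -/
theorem exists_defect {K E : Type*}
    [NormedAddCommGroup K] [InnerProductSpace ℂ K] [CompleteSpace K]
    [NormedAddCommGroup E] [InnerProductSpace ℂ E] [CompleteSpace E]
    (T : K →L[ℂ] E) (C : ℝ) (hT : ∀ k, ‖T k‖ ≤ C * ‖k‖) :
    ∃ D : K →L[ℂ] K, ∀ k, ‖D k‖ ^ 2 = (C * ‖k‖) ^ 2 - ‖T k‖ ^ 2 := by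
  set S : K →L[ℂ] K := ((C ^ 2 : ℝ) : ℂ) • 1 - (ContinuousLinearMap.adjoint T).comp T with hS
  have hin : ∀ k, inner ℂ (S k) k = (((C * ‖k‖) ^ 2 - ‖T k‖ ^ 2 : ℝ) : ℂ) := by
    intro k
    simp only [hS, sub_apply, smul_apply,
      one_apply_eq_self, ContinuousLinearMap.comp_apply, inner_sub_left,
      inner_smul_left, ContinuousLinearMap.adjoint_inner_left, inner_self_eq_norm_sq_to_K,
      Complex.conj_ofReal]
    push_cast
    simp
    ring
  have hpos : 0 ≤ S := by
    rw [ContinuousLinearMap.nonneg_iff_isPositive, ContinuousLinearMap.isPositive_iff_complex]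
    intro k
    rw [hin k]
    rw [RCLike.re_eq_complex_re, Complex.ofReal_re]
    exact ⟨rfl, sub_nonneg.2 (pow_le_pow_left₀ (norm_nonneg _) (hT k) 2)⟩
  refine ⟨CFC.sqrt S, fun k => ?_⟩
  have hsa : IsSelfAdjoint (CFC.sqrt S) := IsSelfAdjoint.of_nonneg (CFC.sqrt_nonneg S)
  have h1 : inner ℂ (S k) k = ((‖CFC.sqrt S k‖ ^ 2 : ℝ) : ℂ) := by
    conv_lhs => rw [← CFC.sqrt_mul_sqrt_self S hpos]
    rw [mul_apply_eq_comp, ← ContinuousLinearMap.adjoint_inner_right,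
      ← ContinuousLinearMap.star_eq_adjoint, hsa.star_eq, inner_self_eq_norm_sq_to_K]
    push_cast
    rfl
  rw [hin k] at h1
  exact_mod_cast h1.symm

/-- A bounded family of operators converges weakly along any ultrafilter. -/
theorem exists_weak_limit {ι K E : Type*}
    [NormedAddCommGroup K] [InnerProductSpace ℂ K]
    [NormedAddCommGroup E] [InnerProductSpace ℂ E] [CompleteSpace E]
    (U : Ultrafilter ι) (T : ι → K →L[ℂ] E) (C : ℝ) (hT : ∀ i k, ‖T i k‖ ≤ C * ‖k‖) :
    ∃ S : K →L[ℂ] E, ∀ k y, Filter.Tendsto (fun i => inner ℂ (T i k) y) U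
      (nhds (inner ℂ (S k) y)) := by
  have key : ∀ k, ∃ s : E, ‖s‖ ≤ C * ‖k‖ ∧ ∀ y, Filter.Tendsto (fun i => inner ℂ (T i k) y) U
      (nhds (inner ℂ s y)) := by
    intro k
    have hc := WeakDual.isCompact_closedBall (𝕜 := ℂ) (E := E) 0 (C * ‖k‖)
    let f : ι → WeakDual ℂ E :=
      fun i => StrongDual.toWeakDual (InnerProductSpace.toDual ℂ E (T i k))
    obtain ⟨φ, hφ, hlim⟩ := hc.ultrafilter_le_nhds' (U.map f) (by
      refine Ultrafilter.mem_map.2 (Filter.mem_of_superset Filter.univ_mem fun i _ => ?_)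
      simpa [f] using hT i k)
    refine ⟨(InnerProductSpace.toDual ℂ E).symm (WeakDual.toStrongDual φ), ?_, fun y => ?_⟩
    · simpa using hφ
    · rw [InnerProductSpace.toDual_symm_apply]
      exact (WeakDual.eval_continuous y).continuousAt.tendsto.comp
        (show Filter.Tendsto f U _ from hlim)
  choose s hs hlim using key
  refine ⟨LinearMap.mkContinuous ⟨⟨s, fun a b => ?_⟩, fun c a => ?_⟩ C hs, hlim⟩
  · refine ext_inner_right ℂ fun y => tendsto_nhds_unique (hlim (a + b) y) ?_
    simpa [inner_add_left] using (hlim a y).add (hlim b y)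
  · refine ext_inner_right ℂ fun y => tendsto_nhds_unique (hlim (c • a) y) ?_
    simpa [inner_smul_left, mul_comm] using (hlim a y).const_mul (starRingEnd ℂ c)

/-- Pythagoras for a vector in the range and a vector in the kernel of a projection. -/
theorem norm_sq_add_of_proj {E : Type*}
    [NormedAddCommGroup E] [InnerProductSpace ℂ E] [CompleteSpace E]
    {p : E →L[ℂ] E} (hp : IsSelfAdjoint p) {a b : E} (ha : p a = a) (hb : p b = 0) :
    ‖a + b‖ ^ 2 = ‖a‖ ^ 2 + ‖b‖ ^ 2 := by
  have : inner ℂ a b = 0 := by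
    rw [← ha, ← ContinuousLinearMap.adjoint_inner_right, ← ContinuousLinearMap.star_eq_adjoint,
      hp.star_eq, hb, inner_zero_right]
  have := norm_add_sq_eq_norm_sq_add_norm_sq_of_inner_eq_zero a b this
  simpa only [sq] using this

/-- One step of the triangular left inverse construction: passing from a larger projection
`q` to a smaller one `p`. -/
theorem exists_triangular_step {K E : Type*}
    [NormedAddCommGroup K] [InnerProductSpace ℂ K] [CompleteSpace K]
    [NormedAddCommGroup E] [InnerProductSpace ℂ E] [CompleteSpace E]
    (X : E →L[ℂ] K) (T : K →L[ℂ] E) (C : ℝ) (hC : 0 ≤ C) (hT : ∀ k, ‖T k‖ ≤ C * ‖k‖)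
    {p q : E →L[ℂ] E} {r : K →L[ℂ] K} (hp : IsSelfAdjoint p) (hq : IsSelfAdjoint q)
    (hpp : p * p = p) (hqq : q * q = q) (hqp : q * p = p)
    (hrr : r * r = r) (hr : ∀ k, ‖k - r k‖ ≤ ‖k‖)
    (hTX : ∀ y, T (X y) = y - q y) (hqT : ∀ k, q (T k) = 0) (hTr : ∀ k, T (r k) = 0)
    (hX : ∀ y, ‖y - p y‖ ≤ C * ‖X y - r (X y)‖) :
    ∃ S : K →L[ℂ] E, (∀ k, ‖S k‖ ≤ C * ‖k‖) ∧ (∀ y, S (X y) = y - p y) ∧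
      (∀ k, p (S k) = 0) ∧ (∀ k, S (r k) = 0) ∧ ∀ k, S k - q (S k) = T k := by
  have hpq : p * q = p := by
    have := congrArg star hqp
    rwa [star_mul, hp.star_eq, hq.star_eq] at this
  have hpp' : ∀ y, p (p y) = p y := fun y => congrArg (· y) hpp
  have hqq' : ∀ y, q (q y) = q y := fun y => congrArg (· y) hqq
  have hqp' : ∀ y, q (p y) = p y := fun y => congrArg (· y) hqp
  have hpq' : ∀ y, p (q y) = p y := fun y => congrArg (· y) hpq
  have hrr' : ∀ y, r (r y) = r y := fun y => congrArg (· y) hrr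
  obtain ⟨D, hD⟩ := exists_defect T C hT
  obtain ⟨G, hG, hGM⟩ := exists_contraction_comp_eq (D.comp ((1 - r).comp X)) (q - p) (by
    intro y
    refine (sq_le_sq₀ (norm_nonneg _) (norm_nonneg _)).1 ?_
    have h1 : ‖y - p y‖ ^ 2 = ‖q y - p y‖ ^ 2 + ‖y - q y‖ ^ 2 := by
      rw [← norm_sq_add_of_proj hq (by simp [hqq', hqp']) (by simp [hqq'])]
      congr 2; abel
    have h2 := pow_le_pow_left₀ (norm_nonneg _) (hX y) 2
    have h3 : ‖D (X y - r (X y))‖ ^ 2 = (C * ‖X y - r (X y)‖) ^ 2 - ‖y - q y‖ ^ 2 := by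
      rw [hD, map_sub T, hTX, hTr, sub_zero]
    change ‖q y - p y‖ ^ 2 ≤ ‖D (X y - r (X y))‖ ^ 2
    linarith)
  simp only [ContinuousLinearMap.comp_apply, sub_apply,
      one_apply_eq_self] at hGM
  refine ⟨T + (q - p).comp (G.comp (D.comp (1 - r))), fun k => ?_, fun y => ?_, fun k => ?_,
    fun k => ?_, fun k => ?_⟩ <;>
    simp only [add_apply, ContinuousLinearMap.comp_apply,
      sub_apply, one_apply_eq_self]
  · set g := G (D (k - r k)) with hg
    refine (sq_le_sq₀ (norm_nonneg _) (by positivity)).1 ?_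
    rw [add_comm, norm_sq_add_of_proj hq (by simp [hqq', hqp']) (hqT k)]
    have h1 : ‖q g - p g‖ ≤ ‖g‖ := by
      refine (sq_le_sq₀ (norm_nonneg _) (norm_nonneg _)).1 ?_
      have h3 : ‖g‖ ^ 2 = ‖q g‖ ^ 2 + ‖g - q g‖ ^ 2 := by
        rw [← norm_sq_add_of_proj hq (hqq' g) (by simp [hqq'])]
        congr 2; abel
      have h4 : ‖q g‖ ^ 2 = ‖p g‖ ^ 2 + ‖q g - p g‖ ^ 2 := by
        rw [← norm_sq_add_of_proj hp (hpp' g) (by simp [hpp', hpq'])]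
        congr 2; abel
      nlinarith [sq_nonneg ‖p g‖, sq_nonneg ‖g - q g‖]
    have h2 : ‖g‖ ^ 2 ≤ (C * ‖k‖) ^ 2 - ‖T k‖ ^ 2 := by
      calc ‖g‖ ^ 2 ≤ ‖D (k - r k)‖ ^ 2 := pow_le_pow_left₀ (norm_nonneg _) (hG _) 2
        _ = (C * ‖k - r k‖) ^ 2 - ‖T k‖ ^ 2 := by rw [hD, map_sub, hTr, sub_zero]
        _ ≤ _ := by
          have := pow_le_pow_left₀ (by positivity) (mul_le_mul_of_nonneg_left (hr k) hC) 2
          linarith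
    have h5 := pow_le_pow_left₀ (norm_nonneg _) h1 2
    linarith
  · rw [hTX, hGM]
    simp only [map_sub, hqq', hqp', hpp', hpq']
    abel
  · rw [map_add, map_sub, hpq', hpp', sub_self, add_zero, ← hpq', hqT, map_zero]
  · simp [hTr, hrr']
  · simp only [map_add, map_sub, hqT, hqq', hqp']
    abel

/-- Arveson's interpolation theorem: a triangular operator `X` which is uniformly bounded below
modulo every element of the nest has a triangular left inverse. -/
theorem exists_triangular_leftInverse {I K E : Type*} [LinearOrder I] [BoundedOrder I]
    [NormedAddCommGroup K] [InnerProductSpace ℂ K] [CompleteSpace K]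
    [NormedAddCommGroup E] [InnerProductSpace ℂ E] [CompleteSpace E]
    (P : I → E →L[ℂ] E) (R : I → K →L[ℂ] K) (X : E →L[ℂ] K) (C : ℝ) (hC : 0 ≤ C)
    (hP : ∀ i, IsSelfAdjoint (P i)) (hPm : ∀ i j, i ≤ j → P j * P i = P i)
    (hRm : ∀ i j, i ≤ j → R j * R i = R i) (hR : ∀ i k, ‖k - R i k‖ ≤ ‖k‖)
    (hbot : P ⊥ = 0) (htop : P ⊤ = 1)
    (hX : ∀ i y, ‖y - P i y‖ ≤ C * ‖X y - R i (X y)‖) :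
    ∃ T : K →L[ℂ] E, (∀ y, T (X y) = y) ∧ ∀ i k, P i (T (R i k)) = T (R i k) := by
  have fin : ∀ s : Finset I, ∀ a, (∀ i ∈ s, a ≤ i) → ∃ T : K →L[ℂ] E,
      (∀ k, ‖T k‖ ≤ C * ‖k‖) ∧ (∀ y, T (X y) = y - P a y) ∧ (∀ k, P a (T k) = 0) ∧
      (∀ k, T (R a k) = 0) ∧ ∀ i ∈ s, ∀ k, P i (T (R i k)) = T (R i k) := by
    intro s
    induction s using Finset.induction_on_min with
    | empty =>
      intro a _
      obtain ⟨S, h1, h2, h3, h4, -⟩ := exists_triangular_step X 0 C hC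
        (fun k => by simpa using by positivity) (hP a) (hP ⊤) (hPm a a le_rfl)
        (hPm ⊤ ⊤ le_rfl) (hPm a ⊤ le_top) (hRm a a le_rfl) (hR a) (by simp [htop])
        (by simp) (by simp) (hX a)
      exact ⟨S, h1, h2, h3, h4, by simp⟩
    | insert b s hb ih =>
      intro a ha
      obtain ⟨T, t1, t2, t3, t4, t5⟩ := ih b fun i hi => (hb i hi).le
      have hab : a ≤ b := ha b (Finset.mem_insert_self _ _)
      have hTr : ∀ k, T (R a k) = 0 := fun k => by
        rw [← hRm a b hab, mul_apply_eq_comp, t4]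
      obtain ⟨S, h1, h2, h3, h4, h5⟩ := exists_triangular_step X T C hC t1 (hP a) (hP b)
        (hPm a a le_rfl) (hPm b b le_rfl) (hPm a b hab) (hRm a a le_rfl) (hR a) t2 t3 hTr (hX a)
      refine ⟨S, h1, h2, h3, h4, fun i hi k => ?_⟩
      obtain rfl | hi := Finset.mem_insert.1 hi
      · have := h5 (R i k)
        rw [t4, sub_eq_zero] at this
        exact this.symm
      · have hbi : P i * P b = P b := hPm b i (hb i hi).le
        have e1 : S (R i k) = T (R i k) + P b (S (R i k)) := by
          rw [← h5 (R i k)]; abel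
        rw [e1, map_add, t5 i hi, ← mul_apply_eq_comp (P i), hbi]
  choose T hT using fun s : Finset I => fin s ⊥ fun i _ => bot_le
  let U : Ultrafilter (Finset I) := Ultrafilter.of Filter.atTop
  have hU : (U : Filter (Finset I)) ≤ Filter.atTop := Ultrafilter.of_le _
  obtain ⟨S, hS⟩ := exists_weak_limit U T C fun s => (hT s).1
  refine ⟨S, fun y => ext_inner_right ℂ fun z => ?_, fun i k => ext_inner_right ℂ fun z => ?_⟩
  · refine tendsto_nhds_unique (hS (X y) z) (Filter.Tendsto.congr (fun s => ?_) tendsto_const_nhds)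
    rw [(hT s).2.1, hbot]
    simp
  · have hadj : ∀ v w, inner ℂ (P i v) w = inner ℂ v (P i w) := fun v w => by
      rw [← ContinuousLinearMap.adjoint_inner_right, ← ContinuousLinearMap.star_eq_adjoint,
        (hP i).star_eq]
    rw [hadj]
    refine tendsto_nhds_unique (hS (R i k) (P i z)) ((hS (R i k) z).congr' ?_)
    filter_upwards [hU (Filter.mem_atTop {i})] with s hs
    rw [← hadj, (hT s).2.2.2.2 i (hs (Finset.mem_singleton_self i)) k]

namespace Nest

/-- The elements of a nest, ordered by inclusion of ranges. -/
def Elem (𝒩 : Nest H) : Type u := {P // P ∈ 𝒩.carrier}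

instance (𝒩 : Nest H) : LinearOrder 𝒩.Elem where
  le P Q := projLE P.1 Q.1
  le_refl P := (𝒩.isProj P.1 P.2).2
  le_trans P Q S h₁ h₂ := by
    unfold projLE at *
    rw [← h₁, ← mul_assoc, h₂]
  le_antisymm P Q h₁ h₂ := by
    unfold projLE at *
    have := congrArg star h₁
    rw [star_mul, (𝒩.isProj P.1 P.2).1.star_eq, (𝒩.isProj Q.1 Q.2).1.star_eq, h₂] at this
    exact Subtype.ext this.symm
  le_total P Q := 𝒩.chain P.1 P.2 Q.1 Q.2
  toDecidableLE := Classical.decRel _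

instance (𝒩 : Nest H) : BoundedOrder 𝒩.Elem where
  bot := ⟨0, 𝒩.zero_mem⟩
  top := ⟨1, 𝒩.one_mem⟩
  bot_le P := mul_zero P.1
  le_top P := one_mul P.1

theorem isSelfAdjoint (𝒩 : Nest H) {P : H →L[ℂ] H} (hP : P ∈ 𝒩.carrier) : IsSelfAdjoint P :=
  (𝒩.isProj P hP).1

theorem apply_apply (𝒩 : Nest H) {P : H →L[ℂ] H} (hP : P ∈ 𝒩.carrier) (y : H) :
    P (P y) = P y :=
  congrArg (· y) (𝒩.isProj P hP).2

theorem norm_sub_apply_le (𝒩 : Nest H) {P : H →L[ℂ] H} (hP : P ∈ 𝒩.carrier) (y : H) :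
    ‖y - P y‖ ≤ ‖y‖ := by
  refine (sq_le_sq₀ (norm_nonneg _) (norm_nonneg _)).1 ?_
  have h : ‖y‖ ^ 2 = ‖P y‖ ^ 2 + ‖y - P y‖ ^ 2 := by
    rw [← norm_sq_add_of_proj (𝒩.isSelfAdjoint hP) (𝒩.apply_apply hP y)
      (by simp [𝒩.apply_apply hP]), add_sub_cancel]
  nlinarith [sq_nonneg ‖P y‖]

end Nest

theorem mem_nestAlgebra_iff {𝒩 : Nest H} {X : H →L[ℂ] H} :
    X ∈ nestAlgebra 𝒩 ↔ ∀ P ∈ 𝒩.carrier, ∀ y, P (X (P y)) = X (P y) := by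
  refine forall₂_congr fun P _ => ?_
  rw [ContinuousLinearMap.ext_iff]
  refine forall_congr' fun y => ?_
  change X (P y) - P (X (P y)) = 0 ↔ _
  rw [sub_eq_zero, eq_comm]

/-- A finite family of operators that is jointly bounded below modulo every element of the nest
generates the nest algebra as a left ideal. -/
theorem exists_sum_mul_eq_one (𝒩 : Nest H) {κ : Type*} [Fintype κ] (A : κ → H →L[ℂ] H)
    (C : ℝ) (hC : 0 ≤ C)
    (hA : ∀ P ∈ 𝒩.carrier, ∀ y,
      ‖y - P y‖ ^ 2 ≤ C ^ 2 * ∑ j, ‖A j y - P (A j y)‖ ^ 2) :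
    ∃ T : κ → H →L[ℂ] H, (∀ j, T j ∈ nestAlgebra 𝒩) ∧ ∑ j, T j * A j = 1 := by
  classical
  let e := (PiLp.continuousLinearEquiv 2 ℂ (fun _ : κ => H)).symm
  let X : H →L[ℂ] PiLp 2 (fun _ : κ => H) := e.toContinuousLinearMap.comp (.pi A)
  let R (P : H →L[ℂ] H) : PiLp 2 (fun _ : κ => H) →L[ℂ] PiLp 2 (fun _ : κ => H) :=
    e.toContinuousLinearMap.comp (.pi fun j => P.comp (PiLp.proj 2 _ j))
  have hXj : ∀ y j, X y j = A j y := fun _ _ => rfl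
  have hRj : ∀ P k j, R P k j = P (k j) := fun _ _ _ => rfl
  let ι (j : κ) : H →L[ℂ] PiLp 2 (fun _ : κ => H) :=
    e.toContinuousLinearMap.comp (.single ℂ (fun _ : κ => H) j)
  have hιj : ∀ j v, ι j v = PiLp.single 2 j v := fun _ _ => rfl
  obtain ⟨T, hTX, hT⟩ := exists_triangular_leftInverse (I := 𝒩.Elem)
    (fun P => P.1) (fun P => R P.1) X C hC (fun P => 𝒩.isSelfAdjoint P.2)
    (fun P Q h => h)
    (fun P Q h => by
      ext k j
      exact congrArg (· (k j)) (show Q.1 * P.1 = P.1 from h))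
    (fun P k => by
      refine (sq_le_sq₀ (norm_nonneg _) (norm_nonneg _)).1 ?_
      rw [PiLp.norm_sq_eq_of_L2, PiLp.norm_sq_eq_of_L2]
      exact Finset.sum_le_sum fun j _ =>
        pow_le_pow_left₀ (norm_nonneg _) (𝒩.norm_sub_apply_le P.2 (k j)) 2)
    rfl rfl
    (fun P y => by
      refine (sq_le_sq₀ (norm_nonneg _) (by positivity)).1 ?_
      rw [mul_pow, PiLp.norm_sq_eq_of_L2]
      exact hA P.1 P.2 y)
  refine ⟨fun j => T.comp (ι j), fun j => mem_nestAlgebra_iff.2 fun P hP y => ?_, ?_⟩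
  · have : ι j (P y) = R P (ι j y) := by
      ext i
      rw [hRj, hιj, hιj]
      obtain rfl | hij := eq_or_ne i j
      · simp
      · simp [hij]
    simpa only [ContinuousLinearMap.comp_apply, this] using hT ⟨P, hP⟩ (ι j y)
  · ext y
    have hsum : X y = ∑ j, ι j (A j y) := by
      ext i
      rw [hXj, WithLp.ofLp_sum, Finset.sum_apply, Finset.sum_eq_single i]
      · simp [hιj]
      · intro j _ hj
        simp [hιj, hj.symm]
      · simp
    conv_rhs => rw [one_apply_eq_self, ← hTX y, hsum, map_sum]
    simp

theorem IsLeftIdealOf.sum_mul_mem {𝒩 : Nest H} {L : Set (H →L[ℂ] H)} (hL : IsLeftIdealOf 𝒩 L)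
    {κ : Type*} (s : Finset κ) {T A : κ → H →L[ℂ] H} (hT : ∀ j, T j ∈ nestAlgebra 𝒩)
    (hA : ∀ j, A j ∈ L) : ∑ j ∈ s, T j * A j ∈ L :=
  Finset.sum_induction _ (· ∈ L) (fun X Y hX hY => hL.2.2.1 X hX Y hY) hL.2.1
    fun j _ => hL.2.2.2.2 _ (hT j) _ (hA j)

/-- A finite subset of a proper left ideal is almost annihilated, modulo some element of the
nest, by some unit vector. -/
theorem IsLeftIdealOf.exists_unit_vector {𝒩 : Nest H} {L : Set (H →L[ℂ] H)}
    (hL : IsLeftIdealOf 𝒩 L) (hne : L ≠ (nestAlgebra 𝒩 : Set (H →L[ℂ] H)))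
    (F : Finset L) {δ : ℝ} (hδ : 0 < δ) :
    ∃ P ∈ 𝒩.carrier, ∃ x : H, ‖x‖ = 1 ∧ (1 - P) x = x ∧
      ∀ X ∈ F, ‖(1 - P) (X.1 x)‖ ≤ δ := by
  by_contra! hcon
  have hlow : ∀ P ∈ 𝒩.carrier, ∀ y,
      ‖y - P y‖ ^ 2 ≤ δ⁻¹ ^ 2 * ∑ X : F, ‖X.1.1 y - P (X.1.1 y)‖ ^ 2 := by
    intro P hP y
    by_cases hz : y - P y = 0
    · rw [hz, norm_zero, zero_pow two_ne_zero]
      positivity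
    set z := y - P y with hzdef
    have hnz : 0 < ‖z‖ := norm_pos_iff.2 hz
    have hPz : P z = 0 := by simp [hzdef, 𝒩.apply_apply hP]
    obtain ⟨X, hX, hXδ⟩ := hcon P hP (((‖z‖⁻¹ : ℝ) : ℂ) • z)
      (by rw [norm_smul, Complex.norm_real, norm_inv, norm_norm, inv_mul_cancel₀ hnz.ne'])
      (by simp [hPz])
    have hXz : X.1 z - P (X.1 z) = X.1 y - P (X.1 y) := by
      have := mem_nestAlgebra_iff.1 (hL.1 X.2) P hP y
      rw [hzdef, map_sub, map_sub, this]
      abel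
    rw [map_smul, map_smul, norm_smul, Complex.norm_real, norm_inv, norm_norm, sub_apply,
      one_apply_eq_self, hXz, lt_inv_mul_iff₀ hnz] at hXδ
    have h1 : ‖z‖ ≤ δ⁻¹ * ‖X.1 y - P (X.1 y)‖ := by
      rw [le_inv_mul_iff₀ hδ, mul_comm]
      exact hXδ.le
    calc ‖z‖ ^ 2 ≤ (δ⁻¹ * ‖X.1 y - P (X.1 y)‖) ^ 2 :=
          pow_le_pow_left₀ (norm_nonneg _) h1 2
      _ = δ⁻¹ ^ 2 * ‖X.1 y - P (X.1 y)‖ ^ 2 := mul_pow _ _ _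
      _ ≤ _ := by
        refine mul_le_mul_of_nonneg_left ?_ (by positivity)
        exact Finset.single_le_sum (f := fun X : F => ‖X.1.1 y - P (X.1.1 y)‖ ^ 2)
          (fun _ _ => by positivity) (Finset.mem_univ (⟨X, hX⟩ : F))
  obtain ⟨T, hT, hsum⟩ := exists_sum_mul_eq_one 𝒩 (fun X : F => X.1.1) δ⁻¹ (by positivity) hlow
  have h1 : (1 : H →L[ℂ] H) ∈ L :=
    hsum ▸ hL.sum_mul_mem Finset.univ hT fun X => X.1.2
  exact hne (hL.1.antisymm fun X hX => mul_one X ▸ hL.2.2.2.2 X hX 1 h1)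

theorem isLeftIdealOf_constructedIdeal (𝒩 : Nest H) {A : Type u} [Preorder A]
    {Nf : A → H →L[ℂ] H} (hN : ∀ α, Nf α ∈ 𝒩.carrier) (x : A → H) :
    IsLeftIdealOf 𝒩 (constructedIdeal 𝒩 Nf x) := by
  refine ⟨fun X hX => hX.1, ⟨zero_mem _, by simpa using tendsto_const_nhds⟩,
    fun X hX Y hY => ⟨add_mem hX.1 hY.1, ?_⟩,
    fun c X hX => ⟨Subalgebra.smul_mem _ hX.1 c, ?_⟩, fun T hT X hX => ⟨mul_mem hT hX.1, ?_⟩⟩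
  · refine squeeze_zero (fun _ => norm_nonneg _) (fun α => ?_) (by simpa using hX.2.add hY.2)
    rw [add_apply, map_add]
    exact norm_add_le _ _
  · refine squeeze_zero (fun _ => norm_nonneg _) (fun α => ?_)
      (by simpa using hX.2.const_mul ‖c‖)
    rw [smul_apply, map_smul, norm_smul]
    rfl
  · refine squeeze_zero (fun _ => norm_nonneg _) (fun α => ?_)
      (by simpa using hX.2.const_mul ‖T‖)
    set v := X (x α)
    have h := mem_nestAlgebra_iff.1 hT (Nf α) (hN α) v
    have heq : T v - Nf α (T v) = T (v - Nf α v) - Nf α (T (v - Nf α v)) := by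
      simp only [map_sub, h]
      abel
    calc ‖T v - Nf α (T v)‖ = ‖T (v - Nf α v) - Nf α (T (v - Nf α v))‖ := by rw [heq]
      _ ≤ ‖T (v - Nf α v)‖ := 𝒩.norm_sub_apply_le (hN α) _
      _ ≤ ‖T‖ * ‖v - Nf α v‖ := T.le_opNorm _

/-- every maximal left ideal of a nest algebra is strongly constructible. -/
theorem statement7 (𝒩 : Nest H) (L : Set (H →L[ℂ] H))
    (hL : IsMaximalLeftIdealOf 𝒩 L) : IsStronglyConstructible 𝒩 L := by
  classical
  obtain ⟨hL, hne, hmax⟩ := hL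
  choose P hP x hx hPx hsmall using fun α : Finset L × ℕ =>
    hL.exists_unit_vector hne α.1 (δ := 1 / ((α.2 : ℝ) + 1)) (by positivity)
  refine ⟨Finset L × ℕ, inferInstance, inferInstance, inferInstance, P, x, hP, hx, hPx, ?_⟩
  have hsub : L ⊆ constructedIdeal 𝒩 P x := by
    refine fun X hX => ⟨hL.1 hX, ?_⟩
    refine squeeze_zero' (Filter.Eventually.of_forall fun _ => norm_nonneg _) ?_
      ((tendsto_one_div_add_atTop_nhds_zero_nat (𝕜 := ℝ)).comp
        (Filter.tendsto_snd.mono_left (Filter.prod_atTop_atTop_eq (α := Finset L)).ge))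
    filter_upwards [Filter.mem_atTop (({⟨X, hX⟩}, 0) : Finset L × ℕ)] with α hα
    exact hsmall α ⟨X, hX⟩ (hα.1 (Finset.mem_singleton_self _))
  obtain h | h := hmax _ (isLeftIdealOf_constructedIdeal 𝒩 hP x) hsub
  · exact h.symm
  · have h1 : (1 : H →L[ℂ] H) ∈ constructedIdeal 𝒩 P x := h ▸ one_mem (nestAlgebra 𝒩)
    have h0 := h1.2
    simp only [one_apply_eq_self, hPx, hx] at h0
    exact absurd (tendsto_nhds_unique h0 tendsto_const_nhds) zero_ne_one
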